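/- Let 1 ≤ p < ∞ and let (U,V) be a pair of n×n matrix weights on ℝ^d with [U,V]_{A_p} < ∞. Let φ ∈ C_c^∞(B(0,1)) be non-negative, radially symmetric and decreasing with ∫φ dx = 1, and set φ_t(x) = t^{−d} φ(x/t) for t > 0. Then: (i) sup_{t>0} ‖φ_t * f‖_{L^p(U)} ≤ C ‖f‖_{L^p(V)} with C independent of f; and (ii) for every f ∈ L^p(V), lim_{t→0} ‖φ_t * f − f‖_{L^p(U)} = 0. -/

import Mathlib

open MeasureTheory ENNReal
open scoped NNReal ComplexOrder

noncomputable section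

abbrev Rd (d : ℕ) := EuclideanSpace ℝ (Fin d)
abbrev Cn (n : ℕ) := EuclideanSpace ℂ (Fin n)
abbrev Mat (n : ℕ) := Matrix (Fin n) (Fin n) ℂ

/-- An axis-parallel (half-open) cube in `ℝ^d`. -/
structure Cube (d : ℕ) where
  corner : Fin d → ℝ
  side : ℝ
  side_pos : 0 < side

namespace Cube

/-- The set of points of a cube. -/
def set {d : ℕ} (Q : Cube d) : Set (Rd d) :=
  {x | ∀ i, Q.corner i ≤ x i ∧ x i < Q.corner i + Q.side}

/-- The volume `|Q|` of a cube. -/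
def vol {d : ℕ} (Q : Cube d) : ℝ := Q.side ^ d

end Cube

/-- A matrix acting on `ℂ^n` (with the Euclidean norm). -/
def mulVecE {n : ℕ} (A : Mat n) (v : Cn n) : Cn n :=
  Matrix.toEuclideanLin A v

/-- The operator norm `|A|_op` of a matrix acting on `ℓ²(ℂ^n)`. -/
def opNorm {n : ℕ} (A : Mat n) : ℝ :=
  ‖Matrix.toEuclideanCLM (𝕜 := ℂ) A‖

/-- Real powers of a self-adjoint matrix, defined via diagonalization. -/
def matPow {n : ℕ} (A : Mat n) (r : ℝ) : Mat n :=
  if hA : A.IsHermitian then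
    (hA.eigenvectorUnitary : Mat n) *
      Matrix.diagonal (fun i => ((hA.eigenvalues i ^ r : ℝ) : ℂ)) *
      (star hA.eigenvectorUnitary : Mat n)
  else A

/-- A matrix weight: self-adjoint matrix valued, locally integrable entries,
positive definite a.e. -/
def IsMatrixWeight {d n : ℕ} (U : Rd d → Mat n) : Prop :=
  (∀ i j, MeasureTheory.LocallyIntegrable (fun x => U x i j) volume) ∧
    (∀ᵐ x, (U x).PosDef)

/-- A Young function: convex, increasing, `Φ(0) = 0` and `Φ(t)/t → ∞`. -/
structure IsYoungFunction (Φ : ℝ → ℝ) : Prop where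
  convexOn : ConvexOn ℝ (Set.Ici 0) Φ
  monotoneOn : MonotoneOn Φ (Set.Ici 0)
  map_zero : Φ 0 = 0
  tendsto : Filter.Tendsto (fun t => Φ t / t) Filter.atTop Filter.atTop

/-- The associate Young function `Φ̄(t) = sup_{s>0} (st - Φ(s))`. -/
def assoc (Φ : ℝ → ℝ) : ℝ → ℝ :=
  fun t => sSup ((fun s => s * t - Φ s) '' Set.Ioi (0 : ℝ))

/-- The `B_{p,q}` condition: `∫_1^∞ Φ(t)^{q/p} t^{-q} dt/t < ∞`. -/
def MemBpq (Φ : ℝ → ℝ) (p q : ℝ) : Prop :=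
  ∫⁻ t in Set.Ioi (1 : ℝ), ENNReal.ofReal (Φ t ^ (q / p) / t ^ (q + 1)) < ⊤

/-- The `B_p` condition: `∫_1^∞ Φ(t) t^{-p} dt/t < ∞`. -/
def MemBp (Φ : ℝ → ℝ) (p : ℝ) : Prop :=
  ∫⁻ t in Set.Ioi (1 : ℝ), ENNReal.ofReal (Φ t / t ^ (p + 1)) < ⊤

/-- Localized Luxemburg (Orlicz) norm over a cube, for `ℝ≥0∞`-valued functions. -/
def luxNormE {d : ℕ} (Φ : ℝ → ℝ) (Q : Cube d) (f : Rd d → ℝ≥0∞) : ℝ≥0∞ :=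
  sInf {lam : ℝ≥0∞ | 0 < lam ∧ lam < ⊤ ∧
    (∫⁻ x in Q.set, ENNReal.ofReal (Φ ((f x).toReal / lam.toReal))) ≤ ENNReal.ofReal Q.vol}

/-- Localized Luxemburg (Orlicz) norm over a cube of a real valued function. -/
def luxNorm {d : ℕ} (Φ : ℝ → ℝ) (Q : Cube d) (f : Rd d → ℝ) : ℝ≥0∞ :=
  luxNormE Φ Q fun x => ENNReal.ofReal |f x|

/-- The (unweighted) `L^p` norm of a vector valued function. -/
def lpNorm {d n : ℕ} (p : ℝ) (f : Rd d → Cn n) : ℝ≥0∞ :=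
  (∫⁻ x, (‖f x‖₊ : ℝ≥0∞) ^ p) ^ (1 / p)

/-- The matrix-weighted `L^p(W)` norm `(∫ |W^{1/p} f|^p)^{1/p}`. -/
def wLpNorm {d n : ℕ} (p : ℝ) (W : Rd d → Mat n) (f : Rd d → Cn n) : ℝ≥0∞ :=
  (∫⁻ x, (‖mulVecE (matPow (W x) (1 / p)) (f x)‖₊ : ℝ≥0∞) ^ p) ^ (1 / p)


/-- The two-weight matrix `A_{p,q}^α` constant (for `p > 1`). -/
def matrixApq {d n : ℕ} (α p q : ℝ) (U V : Rd d → Mat n) : ℝ≥0∞ :=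
  ⨆ Q : Cube d,
    ENNReal.ofReal (Q.vol ^ (α / (d : ℝ) + 1 / q - 1 / p)) *
      ((ENNReal.ofReal Q.vol)⁻¹ *
        ∫⁻ x in Q.set,
          ((ENNReal.ofReal Q.vol)⁻¹ *
            ∫⁻ y in Q.set,
              ENNReal.ofReal (opNorm (matPow (U x) (1 / q) * matPow (V y) (-(1 / p)))) ^
                (p / (p - 1))) ^ (q * (p - 1) / p)) ^ (1 / q)

/-- The two-weight matrix `A_{1,q}^α` constant. -/
def matrixA1q {d n : ℕ} (α q : ℝ) (U V : Rd d → Mat n) : ℝ≥0∞ :=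
  ⨆ Q : Cube d,
    ENNReal.ofReal (Q.vol ^ (α / (d : ℝ) + 1 / q - 1)) *
      essSup (fun y =>
          ((ENNReal.ofReal Q.vol)⁻¹ *
            ∫⁻ x in Q.set,
              ENNReal.ofReal (opNorm (matPow (U x) (1 / q) * (V y)⁻¹)) ^ q) ^ (1 / q))
        (volume.restrict Q.set)

/-- The two-weight matrix `A_{p,q}^α` constant for `1 ≤ p ≤ q`. -/
def matrixApqFull {d n : ℕ} (α p q : ℝ) (U V : Rd d → Mat n) : ℝ≥0∞ :=
  if p = 1 then matrixA1q α q U V else matrixApq α p q U V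

/-- The convolution `φ_t * f` with the dilated mollifier `φ_t(x) = t^{-d} φ(x/t)`,
taken componentwise. -/
def mollifyConv {d n : ℕ} (φ : Rd d → ℝ) (t : ℝ) (f : Rd d → Cn n) (x : Rd d) : Cn n :=
  ∫ y, ((t ^ d)⁻¹ * φ (t⁻¹ • (x - y))) • f y

section MatrixPowers

open scoped MatrixOrder Matrix.Norms.L2Operator

variable {n : ℕ}

theorem matPow_eq_rpow {A : Mat n} (hA : A.PosDef) (r : ℝ) : matPow A r = CFC.rpow A r := by
  have h0 : (0 : Mat n) ≤ A := hA.posSemidef.nonneg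
  have h1 : CFC.rpow A r = cfc (fun x : ℝ => x ^ r) A := CFC.rpow_eq_cfc_real h0
  rw [h1, hA.isHermitian.cfc_eq, matPow, dif_pos hA.isHermitian]
  rfl

theorem matPow_neg_mul_matPow {A : Mat n} (hA : A.PosDef) (r : ℝ) :
    matPow A (-r) * matPow A r = 1 := by
  rw [matPow_eq_rpow hA, matPow_eq_rpow hA]
  exact CFC.rpow_neg_mul_rpow r hA.isStrictlyPositive

theorem matPow_one {A : Mat n} (hA : A.PosDef) : matPow A 1 = A := by
  rw [matPow_eq_rpow hA]
  exact CFC.rpow_one A hA.posSemidef.nonneg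

theorem inv_eq_matPow {A : Mat n} (hA : A.PosDef) : A⁻¹ = matPow A (-1) := by
  refine Matrix.inv_eq_left_inv ?_
  have := matPow_neg_mul_matPow hA 1
  rwa [matPow_one hA] at this

theorem opNorm_matPow {A : Mat n} (hA : A.PosDef) {r : ℝ} (hr : 0 < r) :
    opNorm (matPow A r) = opNorm A ^ r := by
  rw [matPow_eq_rpow hA]
  exact CFC.norm_rpow A hr hA.posSemidef.nonneg

theorem continuousOn_matPow (r : ℝ) :
    ContinuousOn (fun A : Mat n => matPow A r) {A | A.PosDef} := by
  have h := CFC.continuousOn_rpow (A := Mat n) r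
  refine (h.mono ?_).congr ?_
  · intro A hA
    exact Matrix.PosDef.isStrictlyPositive hA
  · intro A hA
    exact matPow_eq_rpow hA r

theorem isClosed_posSemidef : IsClosed {A : Mat n | A.PosSemidef} := by
  have : {A : Mat n | A.PosSemidef} = {A : Mat n | 0 ≤ A} := by
    ext A; exact Matrix.nonneg_iff_posSemidef.symm
  rw [this]
  exact CStarAlgebra.isClosed_nonneg

theorem measurableSet_posDef [MeasurableSpace (Mat n)] [BorelSpace (Mat n)] :
    MeasurableSet {A : Mat n | A.PosDef} := by
  have : {A : Mat n | A.PosDef} = {A : Mat n | A.PosSemidef} ∩ {A | IsUnit A} := by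
    ext A
    exact ⟨fun h => ⟨h.posSemidef, h.isUnit⟩, fun h => h.1.posDef_iff_isUnit.2 h.2⟩
  rw [this]
  exact isClosed_posSemidef.measurableSet.inter Units.isOpen.measurableSet

theorem aestronglyMeasurable_of_entries {d : ℕ} {U : Rd d → Mat n}
    (hU : ∀ i j, AEStronglyMeasurable (fun x => U x i j) volume) :
    AEStronglyMeasurable U volume := by
  have h : U = fun x => ∑ i, ∑ j, U x i j • Matrix.single i j (1 : ℂ) := by
    ext x : 1
    conv_lhs => rw [Matrix.matrix_eq_sum_single (U x)]
    simp [Matrix.smul_single]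
  rw [h]
  fun_prop

theorem aestronglyMeasurable_matPow {d : ℕ} {U : Rd d → Mat n} (hU : IsMatrixWeight U) (r : ℝ) :
    AEStronglyMeasurable (fun x => Matrix.toEuclideanCLM (𝕜 := ℂ) (matPow (U x) r)) volume := by
  borelize (Mat n)
  have hm : AEStronglyMeasurable U volume :=
    aestronglyMeasurable_of_entries fun i j => (hU.1 i j).aestronglyMeasurable
  have hS : ∀ᵐ A ∂(volume.map U), A ∈ {A : Mat n | A.PosDef} :=
    (ae_map_iff hm.aemeasurable measurableSet_posDef).2 hU.2
  have h1 : AEStronglyMeasurable (fun A : Mat n => matPow A r) (volume.map U) := by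
    rw [← Measure.restrict_eq_self_of_ae_mem hS]
    exact (continuousOn_matPow r).aestronglyMeasurable measurableSet_posDef
  have h2 := h1.comp_aemeasurable hm.aemeasurable
  have hc : Continuous (Matrix.toEuclideanCLM (n := Fin n) (𝕜 := ℂ)) :=
    LinearMap.continuous_of_finiteDimensional
      (Matrix.toEuclideanCLM (n := Fin n) (𝕜 := ℂ)).toAlgEquiv.toLinearMap
  exact hc.comp_aestronglyMeasurable h2

theorem lintegral_enorm_matPow_lt_top {d : ℕ} {U : Rd d → Mat n} (hU : IsMatrixWeight U)
    {p : ℝ} (hp : 0 < p) {K : Set (Rd d)} (hK : IsCompact K) :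
    ∫⁻ x in K, ‖Matrix.toEuclideanCLM (𝕜 := ℂ) (matPow (U x) (1 / p))‖ₑ ^ p < ⊤ := by
  have h : U = fun x => ∑ i, ∑ j, U x i j • Matrix.single i j (1 : ℂ) := by
    ext x : 1
    conv_lhs => rw [Matrix.matrix_eq_sum_single (U x)]
    simp [Matrix.smul_single]
  have hi : Integrable U (volume.restrict K) := by
    rw [h]
    refine integrable_finsetSum _ fun i _ => integrable_finsetSum _ fun j _ => ?_
    exact Integrable.smul_const ((hU.1 i j).integrableOn_isCompact hK) _
  refine lt_of_eq_of_lt (lintegral_congr_ae ?_) hi.hasFiniteIntegral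
  filter_upwards [ae_restrict_of_ae hU.2] with x hx
  have := opNorm_matPow hx (r := 1 / p) (by positivity)
  have h3 : ‖Matrix.toEuclideanCLM (𝕜 := ℂ) (matPow (U x) (1 / p))‖ₑ =
      ENNReal.ofReal (‖U x‖ ^ (1 / p)) := by
    rw [← ofReal_norm]; exact congrArg _ this
  have h4 : (‖U x‖ ^ (1 / p)) ^ p = ‖U x‖ := by
    rw [← Real.rpow_mul (norm_nonneg _), one_div_mul_cancel hp.ne', Real.rpow_one]
  rw [h3, ENNReal.ofReal_rpow_of_nonneg (Real.rpow_nonneg (norm_nonneg _) _) hp.le, h4]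
  exact ofReal_norm (U x)

end MatrixPowers

theorem Cube.measurableSet_set {d : ℕ} (Q : Cube d) : MeasurableSet Q.set := by
  have : Q.set = ⋂ i, {x : Rd d | Q.corner i ≤ x i ∧ x i < Q.corner i + Q.side} := by
    ext x; simp [Cube.set]
  rw [this]
  refine MeasurableSet.iInter fun i => ?_
  have hm : Measurable fun x : Rd d => x i := by fun_prop
  exact (measurableSet_le measurable_const hm).inter (measurableSet_lt hm measurable_const)

/-- A kernel satisfying a two-index `A_p` bound is bounded on `L^p` of each cube, `1 < p`. -/
theorem lintegral_rpow_lintegral_mul_le {α : Type*} [MeasurableSpace α] {μ : Measure α}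
    {p : ℝ} (hp : 1 < p) {a : α → α → ℝ≥0∞} (ha : ∀ x, AEMeasurable (a x) μ)
    {v S : ℝ≥0∞} (hv0 : v ≠ 0) (hv : v ≠ ⊤)
    (hS : v⁻¹ * ∫⁻ x, (v⁻¹ * ∫⁻ y, a x y ^ (p / (p - 1)) ∂μ) ^ (p - 1) ∂μ ≤ S)
    {g : α → ℝ≥0∞} (hg : AEMeasurable g μ) (hgt : ∫⁻ y, g y ^ p ∂μ ≠ ⊤) :
    ∫⁻ x, (∫⁻ y, a x y * g y ∂μ) ^ p ∂μ ≤ S * v ^ p * ∫⁻ y, g y ^ p ∂μ := by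
  have hp0 : 0 < p := by linarith
  have hp1 : 0 < p - 1 := by linarith
  have hpq : (p / (p - 1)).HolderConjugate p :=
    (Real.HolderConjugate.conjExponent hp).symm
  have hpt : ∀ x, (∫⁻ y, a x y * g y ∂μ) ^ p ≤
      (v ^ (p - 1) * ∫⁻ y, g y ^ p ∂μ) *
        (v⁻¹ * ∫⁻ y, a x y ^ (p / (p - 1)) ∂μ) ^ (p - 1) := by
    intro x
    have h := ENNReal.lintegral_mul_le_Lp_mul_Lq μ hpq (ha x) hg
    calc (∫⁻ y, a x y * g y ∂μ) ^ p
        ≤ ((∫⁻ y, a x y ^ (p / (p - 1)) ∂μ) ^ (1 / (p / (p - 1))) *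
            (∫⁻ y, g y ^ p ∂μ) ^ (1 / p)) ^ p := ENNReal.rpow_le_rpow h hp0.le
      _ = (∫⁻ y, a x y ^ (p / (p - 1)) ∂μ) ^ (p - 1) * ∫⁻ y, g y ^ p ∂μ := by
          rw [ENNReal.mul_rpow_of_nonneg _ _ hp0.le, ← ENNReal.rpow_mul, ← ENNReal.rpow_mul]
          congr 2
          · field_simp
          · rw [one_div_mul_cancel hp0.ne', ENNReal.rpow_one]
      _ = (v ^ (p - 1) * ∫⁻ y, g y ^ p ∂μ) *
            (v⁻¹ * ∫⁻ y, a x y ^ (p / (p - 1)) ∂μ) ^ (p - 1) := by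
          rw [mul_right_comm, ← ENNReal.mul_rpow_of_nonneg _ _ hp1.le, ← mul_assoc,
            ENNReal.mul_inv_cancel hv0 hv, one_mul]
  calc ∫⁻ x, (∫⁻ y, a x y * g y ∂μ) ^ p ∂μ
      ≤ ∫⁻ x, (v ^ (p - 1) * ∫⁻ y, g y ^ p ∂μ) *
        (v⁻¹ * ∫⁻ y, a x y ^ (p / (p - 1)) ∂μ) ^ (p - 1) ∂μ := lintegral_mono hpt
    _ = (v ^ (p - 1) * ∫⁻ y, g y ^ p ∂μ) *
        ∫⁻ x, (v⁻¹ * ∫⁻ y, a x y ^ (p / (p - 1)) ∂μ) ^ (p - 1) ∂μ :=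
        lintegral_const_mul' _ _
          (ENNReal.mul_ne_top (ENNReal.rpow_ne_top_of_nonneg hp1.le hv) hgt)
    _ ≤ (v ^ (p - 1) * ∫⁻ y, g y ^ p ∂μ) * (v * S) := by
        gcongr
        calc _ = v * (v⁻¹ * ∫⁻ x, (v⁻¹ * ∫⁻ y, a x y ^ (p / (p - 1)) ∂μ) ^ (p - 1) ∂μ) := by
              rw [← mul_assoc, ENNReal.mul_inv_cancel hv0 hv, one_mul]
          _ ≤ _ := by gcongr
    _ = S * v ^ p * ∫⁻ y, g y ^ p ∂μ := by
        have : v ^ p = v ^ (p - 1) * v := by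
          conv_rhs => rw [← ENNReal.rpow_one v, ← ENNReal.rpow_mul, one_mul]
          rw [← ENNReal.rpow_add _ _ hv0 hv]; simp
        rw [this]; ring

/-- A kernel satisfying a two-index `A_1` bound is bounded on `L^1` of each cube. -/
theorem lintegral_lintegral_mul_le {α : Type*} [MeasurableSpace α] {μ : Measure α} [SFinite μ]
    {a : α → α → ℝ≥0∞} (ha : AEMeasurable (Function.uncurry a) (μ.prod μ))
    {v S : ℝ≥0∞} (hv0 : v ≠ 0) (hv : v ≠ ⊤)
    (hS : ∀ᵐ y ∂μ, v⁻¹ * ∫⁻ x, a x y ∂μ ≤ S)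
    {g : α → ℝ≥0∞} (hg : AEMeasurable g μ) :
    ∫⁻ x, ∫⁻ y, a x y * g y ∂μ ∂μ ≤ S * v * ∫⁻ y, g y ∂μ := by
  have hm : AEMeasurable (Function.uncurry fun x y => a x y * g y) (μ.prod μ) :=
    ha.mul hg.comp_snd
  rw [lintegral_lintegral_swap hm, ← lintegral_const_mul'' _ hg]
  have hpr : ∀ᵐ y ∂μ, AEMeasurable (fun x => a x y) μ := by
    filter_upwards [ha.prod_swap.aestronglyMeasurable.prodMk_left] with y hy
    exact hy.aemeasurable
  refine lintegral_mono_ae ?_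
  filter_upwards [hS, hpr] with y hy hmy
  rw [lintegral_mul_const'' _ hmy]
  gcongr
  calc ∫⁻ x, a x y ∂μ = v * (v⁻¹ * ∫⁻ x, a x y ∂μ) := by
        rw [← mul_assoc, ENNReal.mul_inv_cancel hv0 hv, one_mul]
    _ ≤ v * S := by gcongr
    _ = S * v := mul_comm _ _

theorem exists_cube_estimate {d n : ℕ} {p : ℝ} (hp : 1 ≤ p) {U V : Rd d → Mat n}
    (hU : IsMatrixWeight U) (hV : IsMatrixWeight V) (hAp : matrixApqFull 0 p p U V < ⊤) :
    ∃ K : ℝ≥0∞, K ≠ ⊤ ∧ ∀ (Q : Cube d) (g : Rd d → ℝ≥0∞), AEMeasurable g volume →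
      ∫⁻ x in Q.set, (∫⁻ y in Q.set,
        ‖Matrix.toEuclideanCLM (𝕜 := ℂ) (matPow (U x) (1 / p)) *
          Matrix.toEuclideanCLM (𝕜 := ℂ) (matPow (V y) (-(1 / p)))‖ₑ * g y) ^ p ≤
      K * ENNReal.ofReal Q.vol ^ p * ∫⁻ y in Q.set, g y ^ p := by
  have hp0 : 0 < p := by linarith
  have hA := aestronglyMeasurable_matPow hU (1 / p)
  have hB := aestronglyMeasurable_matPow hV (-(1 / p))
  have hop : ∀ x y, ENNReal.ofReal (opNorm (matPow (U x) (1 / p) * matPow (V y) (-(1 / p)))) =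
      ‖Matrix.toEuclideanCLM (𝕜 := ℂ) (matPow (U x) (1 / p)) *
          Matrix.toEuclideanCLM (𝕜 := ℂ) (matPow (V y) (-(1 / p)))‖ₑ := by
    intro x y
    rw [opNorm, map_mul, ofReal_norm]
  have hvol : ∀ Q : Cube d, 0 < Q.vol := fun Q => pow_pos Q.side_pos d
  refine ⟨matrixApqFull 0 p p U V ^ p + 1, by finiteness, fun Q g hg => ?_⟩
  have hv0 : ENNReal.ofReal Q.vol ≠ 0 := by simpa using hvol Q
  have hv : ENNReal.ofReal Q.vol ≠ ⊤ := ENNReal.ofReal_ne_top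
  by_cases hgt : ∫⁻ y in Q.set, g y ^ p = ⊤
  · rw [hgt, ENNReal.mul_top]
    · exact le_top
    · refine mul_ne_zero (by simp) ?_
      simp [ENNReal.rpow_eq_zero_iff, hv0, hv]
  rcases hp.eq_or_lt with h1 | h1
  · subst h1
    simp only [matrixApqFull, if_true, ENNReal.rpow_one]
    refine (lintegral_lintegral_mul_le (S := matrixA1q 0 1 U V) ?_ hv0 hv ?_ hg.restrict).trans ?_
    · refine AEStronglyMeasurable.enorm ?_
      exact (hA.restrict.comp_fst).mul (hB.restrict.comp_snd)
    · have hle := le_iSup (fun Q : Cube d => ENNReal.ofReal (Q.vol ^ (0 / (d : ℝ) + 1 / 1 - 1)) *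
        essSup (fun y =>
          ((ENNReal.ofReal Q.vol)⁻¹ *
            ∫⁻ x in Q.set,
              ENNReal.ofReal (opNorm (matPow (U x) (1 / 1) * (V y)⁻¹)) ^ (1 : ℝ)) ^ (1 / 1 : ℝ))
        (volume.restrict Q.set)) Q
      have h0 : ENNReal.ofReal (Q.vol ^ (0 / (d : ℝ) + 1 / 1 - 1)) = 1 := by simp
      simp only [h0, one_mul] at hle
      filter_upwards [ENNReal.ae_le_essSup (μ := volume.restrict Q.set) (fun y =>
          ((ENNReal.ofReal Q.vol)⁻¹ *
            ∫⁻ x in Q.set,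
              ENNReal.ofReal (opNorm (matPow (U x) (1 / 1) * (V y)⁻¹)) ^ (1 : ℝ)) ^ (1 / 1 : ℝ)),
        ae_restrict_of_ae hV.2] with y hy hVy
      refine le_trans (le_of_eq ?_) (hy.trans hle)
      have : (V y)⁻¹ = matPow (V y) (-(1 / 1)) := by
        rw [inv_eq_matPow hVy]; norm_num
      simp_rw [this, hop, ENNReal.rpow_one, one_div_one, ENNReal.rpow_one]
    · gcongr
      exact le_self_add
  · have hne : p ≠ 1 := h1.ne'
    simp only [matrixApqFull, if_neg hne]
    refine (lintegral_rpow_lintegral_mul_le (S := matrixApq 0 p p U V ^ p) h1 ?_ hv0 hv ?_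
      hg.restrict hgt).trans ?_
    · intro x
      refine AEStronglyMeasurable.enorm ?_
      exact (aestronglyMeasurable_const.mul hB).restrict
    · have hle := le_iSup (fun Q : Cube d =>
        ENNReal.ofReal (Q.vol ^ (0 / (d : ℝ) + 1 / p - 1 / p)) *
      ((ENNReal.ofReal Q.vol)⁻¹ *
        ∫⁻ x in Q.set,
          ((ENNReal.ofReal Q.vol)⁻¹ *
            ∫⁻ y in Q.set,
              ENNReal.ofReal (opNorm (matPow (U x) (1 / p) * matPow (V y) (-(1 / p)))) ^
                (p / (p - 1))) ^ (p * (p - 1) / p)) ^ (1 / p)) Q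
      change _ ≤ matrixApq 0 p p U V at hle
      have h0 : ENNReal.ofReal (Q.vol ^ (0 / (d : ℝ) + 1 / p - 1 / p)) = 1 := by simp
      have h2 : p * (p - 1) / p = p - 1 := by field_simp
      simp only [h0, one_mul, h2, hop] at hle
      have := ENNReal.rpow_le_rpow hle hp0.le
      rwa [← ENNReal.rpow_mul, one_div_mul_cancel hp0.ne', ENNReal.rpow_one] at this
    · gcongr
      exact le_self_add

/-- The cube of side `t` of the lattice `t ℤ^d` with index `k`. -/
def gridCube {d : ℕ} {t : ℝ} (ht : 0 < t) (k : Fin d → ℤ) : Cube d where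
  corner i := t * k i
  side := t
  side_pos := ht

/-- The threefold dilate of a lattice cube. -/
def gridCubeTriple {d : ℕ} {t : ℝ} (ht : 0 < t) (k : Fin d → ℤ) : Cube d where
  corner i := t * (k i - 1)
  side := 3 * t
  side_pos := by positivity

section Grid

variable {d : ℕ} {t : ℝ} (ht : 0 < t)

theorem mem_gridCube_iff {k : Fin d → ℤ} {x : Rd d} :
    x ∈ (gridCube ht k).set ↔ ∀ i, ⌊x i / t⌋ = k i := by
  simp only [Cube.set, gridCube, Set.mem_ofPred_eq]
  refine forall_congr' fun i => ?_
  rw [Int.floor_eq_iff, le_div_iff₀ ht, div_lt_iff₀ ht, add_mul, one_mul, mul_comm t]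

theorem iUnion_gridCube : ⋃ k, (gridCube (d := d) ht k).set = Set.univ := by
  refine Set.eq_univ_of_forall fun x => Set.mem_iUnion.2 ⟨fun i => ⌊x i / t⌋, ?_⟩
  simp [mem_gridCube_iff]

theorem pairwise_disjoint_gridCube :
    Pairwise (Function.onFun Disjoint fun k => (gridCube (d := d) ht k).set) := by
  intro k l hkl
  refine Set.disjoint_left.2 fun x hx hy => hkl ?_
  ext i
  rw [← (mem_gridCube_iff ht).1 hx i, (mem_gridCube_iff ht).1 hy i]

theorem gridCube_subset_triple (k : Fin d → ℤ) :
    (gridCube ht k).set ⊆ (gridCubeTriple ht k).set := by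
  intro x hx i
  have := hx i
  simp only [gridCube, gridCubeTriple] at this ⊢
  constructor <;> nlinarith

theorem mem_gridCubeTriple {k : Fin d → ℤ} {x y : Rd d} (hx : x ∈ (gridCube ht k).set)
    (hxy : ‖x - y‖ < t) : y ∈ (gridCubeTriple ht k).set := by
  intro i
  have := hx i
  have h2 : |x i - y i| ≤ ‖x - y‖ := PiLp.norm_apply_le (x - y) i
  have h3 := abs_lt.1 (h2.trans_lt hxy)
  simp only [gridCube, gridCubeTriple] at this ⊢
  constructor <;> nlinarith

theorem gridCubeTriple_subset (k : Fin d → ℤ) :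
    (gridCubeTriple ht k).set ⊆
      ⋃ j : Fin d → Fin 3, (gridCube ht (k + fun i => ((j i : ℕ) : ℤ) - 1)).set := by
  intro x hx
  have hb : ∀ i, 0 ≤ ⌊x i / t⌋ - k i + 1 ∧ ⌊x i / t⌋ - k i + 1 < 3 := by
    intro i
    have := hx i
    simp only [gridCubeTriple] at this
    constructor
    · have : k i - 1 ≤ ⌊x i / t⌋ := by
        rw [Int.le_floor, le_div_iff₀ ht]; push_cast; linarith
      omega
    · have : ⌊x i / t⌋ < k i + 2 := by
        rw [Int.floor_lt, div_lt_iff₀ ht]; push_cast; linarith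
      omega
  refine Set.mem_iUnion.2 ⟨fun i => ⟨(⌊x i / t⌋ - k i + 1).toNat, by have := hb i; omega⟩, ?_⟩
  rw [mem_gridCube_iff]
  intro i
  have := hb i
  simp only [Pi.add_apply]
  omega

theorem tsum_lintegral_gridCube (h : Rd d → ℝ≥0∞) :
    ∑' k, ∫⁻ x in (gridCube (d := d) ht k).set, h x = ∫⁻ x, h x := by
  rw [← lintegral_iUnion (fun k => (gridCube ht k).measurableSet_set)
    (pairwise_disjoint_gridCube ht), iUnion_gridCube ht, Measure.restrict_univ]

theorem tsum_lintegral_gridCubeTriple_le (h : Rd d → ℝ≥0∞) :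
    ∑' k, ∫⁻ x in (gridCubeTriple (d := d) ht k).set, h x ≤ 3 ^ d * ∫⁻ x, h x := by
  calc ∑' k, ∫⁻ x in (gridCubeTriple (d := d) ht k).set, h x
      ≤ ∑' k : Fin d → ℤ, ∑' j : Fin d → Fin 3,
          ∫⁻ x in (gridCube ht (k + fun i => ((j i : ℕ) : ℤ) - 1)).set, h x :=
        ENNReal.tsum_le_tsum fun k =>
          (lintegral_mono_set (gridCubeTriple_subset ht k)).trans (lintegral_iUnion_le _ _)
    _ = ∑' j : Fin d → Fin 3, ∑' k : Fin d → ℤ,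
          ∫⁻ x in (gridCube ht (k + fun i => ((j i : ℕ) : ℤ) - 1)).set, h x :=
        ENNReal.tsum_comm
    _ = ∑' _ : Fin d → Fin 3, ∫⁻ x, h x := by
        refine tsum_congr fun j => ?_
        rw [← tsum_lintegral_gridCube ht h]
        exact (Equiv.addRight (fun i => ((j i : ℕ) : ℤ) - 1)).tsum_eq
          (fun k => ∫⁻ x in (gridCube (d := d) ht k).set, h x)
    _ = 3 ^ d * ∫⁻ x, h x := by
        rw [tsum_fintype]
        simp

end Grid

theorem lintegral_rpow_mollified_kernel_le {d : ℕ} {p : ℝ} (hp : 0 < p)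
    {a : Rd d → Rd d → ℝ≥0∞} {K : ℝ≥0∞}
    (hK : ∀ (Q : Cube d) (g : Rd d → ℝ≥0∞), AEMeasurable g volume →
      ∫⁻ x in Q.set, (∫⁻ y in Q.set, a x y * g y) ^ p ≤
        K * ENNReal.ofReal Q.vol ^ p * ∫⁻ y in Q.set, g y ^ p)
    {φ : Rd d → ℝ} {M : ℝ} (hM : 0 ≤ M) (hφM : ∀ x, φ x ≤ M) (hφ1 : ∀ x, φ x ≠ 0 → ‖x‖ < 1)
    {t : ℝ} (ht : 0 < t) {g : Rd d → ℝ≥0∞} (hg : AEMeasurable g volume) :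
    ∫⁻ x, (∫⁻ y, ENNReal.ofReal ((t ^ d)⁻¹ * φ (t⁻¹ • (x - y))) * (a x y * g y)) ^ p ≤
      3 ^ d * (ENNReal.ofReal (M * 3 ^ d) ^ p * K) * ∫⁻ y, g y ^ p := by
  have hcube : ∀ k : Fin d → ℤ, ∫⁻ x in (gridCube ht k).set,
      (∫⁻ y, ENNReal.ofReal ((t ^ d)⁻¹ * φ (t⁻¹ • (x - y))) * (a x y * g y)) ^ p ≤
      (ENNReal.ofReal (M * 3 ^ d) ^ p * K) *
        ∫⁻ y in (gridCubeTriple ht k).set, g y ^ p := by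
    intro k
    set Q := gridCubeTriple ht k with hQ
    set c := ENNReal.ofReal ((t ^ d)⁻¹ * M) with hc
    have hct : c ^ p ≠ ⊤ := ENNReal.rpow_ne_top_of_nonneg hp.le ENNReal.ofReal_ne_top
    have hpt : ∀ x ∈ (gridCube ht k).set,
        (∫⁻ y, ENNReal.ofReal ((t ^ d)⁻¹ * φ (t⁻¹ • (x - y))) * (a x y * g y)) ^ p ≤
          c ^ p * (∫⁻ y in Q.set, a x y * g y) ^ p := by
      intro x hx
      rw [← ENNReal.mul_rpow_of_nonneg _ _ hp.le]
      refine ENNReal.rpow_le_rpow ?_ hp.le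
      rw [← lintegral_const_mul' _ _ ENNReal.ofReal_ne_top,
        ← lintegral_indicator Q.measurableSet_set]
      refine lintegral_mono fun y => ?_
      by_cases hy : φ (t⁻¹ • (x - y)) = 0
      · simp [hy]
      · have h1 := hφ1 _ hy
        rw [norm_smul, Real.norm_of_nonneg (by positivity), inv_mul_lt_iff₀ ht, mul_one] at h1
        rw [Set.indicator_of_mem (mem_gridCubeTriple ht hx h1)]
        gcongr
        exact hφM _
    have hcv : c * ENNReal.ofReal Q.vol = ENNReal.ofReal (M * 3 ^ d) := by
      rw [hc, ← ENNReal.ofReal_mul (by positivity)]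
      congr 1
      simp only [hQ, Cube.vol, gridCubeTriple, mul_pow]
      field_simp
    calc _ ≤ ∫⁻ x in (gridCube ht k).set, c ^ p * (∫⁻ y in Q.set, a x y * g y) ^ p :=
          setLIntegral_mono' (gridCube ht k).measurableSet_set hpt
      _ ≤ ∫⁻ x in Q.set, c ^ p * (∫⁻ y in Q.set, a x y * g y) ^ p :=
          lintegral_mono_set (gridCube_subset_triple ht k)
      _ = c ^ p * ∫⁻ x in Q.set, (∫⁻ y in Q.set, a x y * g y) ^ p :=
          lintegral_const_mul' _ _ hct
      _ ≤ c ^ p * (K * ENNReal.ofReal Q.vol ^ p * ∫⁻ y in Q.set, g y ^ p) := by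
          gcongr
          exact hK Q g hg
      _ = _ := by
          rw [← hcv, ENNReal.mul_rpow_of_nonneg _ _ hp.le]; ring
  calc _ = ∫⁻ x in ⋃ k, (gridCube (d := d) ht k).set,
        (∫⁻ y, ENNReal.ofReal ((t ^ d)⁻¹ * φ (t⁻¹ • (x - y))) * (a x y * g y)) ^ p := by
        rw [iUnion_gridCube ht, Measure.restrict_univ]
    _ ≤ ∑' k : Fin d → ℤ, ∫⁻ x in (gridCube ht k).set,
        (∫⁻ y, ENNReal.ofReal ((t ^ d)⁻¹ * φ (t⁻¹ • (x - y))) * (a x y * g y)) ^ p :=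
        lintegral_iUnion_le _ _
    _ ≤ ∑' k : Fin d → ℤ, (ENNReal.ofReal (M * 3 ^ d) ^ p * K) *
        ∫⁻ y in (gridCubeTriple ht k).set, g y ^ p := ENNReal.tsum_le_tsum hcube
    _ = (ENNReal.ofReal (M * 3 ^ d) ^ p * K) *
        ∑' k : Fin d → ℤ, ∫⁻ y in (gridCubeTriple ht k).set, g y ^ p := ENNReal.tsum_mul_left
    _ ≤ (ENNReal.ofReal (M * 3 ^ d) ^ p * K) * (3 ^ d * ∫⁻ y, g y ^ p) := by
        gcongr
        exact tsum_lintegral_gridCubeTriple_le ht _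
    _ = _ := by ring

section Mollify

variable {d n : ℕ} {φ : Rd d → ℝ}

theorem enorm_apply_mollifyConv_le (hφ0 : ∀ x, 0 ≤ φ x) {t : ℝ} (ht : 0 < t)
    (A : Cn n →L[ℂ] Cn n) (f : Rd d → Cn n) (x : Rd d) :
    ‖A (mollifyConv φ t f x)‖ₑ ≤
      ∫⁻ y, ENNReal.ofReal ((t ^ d)⁻¹ * φ (t⁻¹ • (x - y))) * ‖A (f y)‖ₑ := by
  by_cases hi : Integrable (fun y => ((t ^ d)⁻¹ * φ (t⁻¹ • (x - y))) • f y) volume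
  · have h : A (mollifyConv φ t f x) = ∫ y, ((t ^ d)⁻¹ * φ (t⁻¹ • (x - y))) • A (f y) := by
      rw [mollifyConv, ← A.integral_comp_comm hi]
      refine integral_congr_ae (Filter.Eventually.of_forall fun y => ?_)
      exact (A.restrictScalars ℝ).map_smul _ _
    rw [h]
    refine (enorm_integral_le_lintegral_enorm _).trans (lintegral_mono fun y => ?_)
    rw [enorm_smul, Real.enorm_of_nonneg]
    exact mul_nonneg (by positivity) (hφ0 _)
  · rw [mollifyConv, integral_undef hi]
    simp

theorem aestronglyMeasurable_mollifyConv (hφ : Continuous φ) (t : ℝ) {f : Rd d → Cn n}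
    (hf : AEStronglyMeasurable f volume) :
    AEStronglyMeasurable (mollifyConv φ t f) volume := by
  refine AEStronglyMeasurable.integral_prod_right'
    (f := fun z : Rd d × Rd d => ((t ^ d)⁻¹ * φ (t⁻¹ • (z.1 - z.2))) • f z.2) ?_
  have h1 : AEStronglyMeasurable (fun z : Rd d × Rd d => (t ^ d)⁻¹ * φ (t⁻¹ • (z.1 - z.2)))
      (volume.prod volume) := Continuous.aestronglyMeasurable (by fun_prop)
  have h2 : AEStronglyMeasurable (fun z : Rd d × Rd d => f z.2) (volume.prod volume) :=
    hf.comp_snd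
  exact h1.smul h2

/-- The part of `f` that the mollification sees is a.e. strongly measurable. -/
theorem exists_aestronglyMeasurable_mollifyConv (hφ : Continuous φ) {t : ℝ} (ht : 0 < t)
    (f : Rd d → Cn n) :
    ∃ G : Set (Rd d), MeasurableSet G ∧ AEStronglyMeasurable (G.indicator f) volume ∧
      ∀ x, mollifyConv φ t f x = mollifyConv φ t (G.indicator f) x ∨ mollifyConv φ t f x = 0 := by
  set X : Set (Rd d) :=
    {x | Integrable (fun y => ((t ^ d)⁻¹ * φ (t⁻¹ • (x - y))) • f y) volume} with hX
  set S : Rd d → Set (Rd d) := fun x => {y | φ (t⁻¹ • (x - y)) ≠ 0} with hS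
  have hSo : ∀ x, IsOpen (S x) := fun x =>
    isOpen_ne_fun (by fun_prop) continuous_const
  have hG : IsOpen (⋃ x ∈ X, S x) := isOpen_biUnion fun x _ => hSo x
  refine ⟨⋃ x ∈ X, S x, hG.measurableSet, ?_, fun x => ?_⟩
  · rw [aestronglyMeasurable_indicator_iff hG.measurableSet]
    obtain ⟨T, hTc, hT⟩ := TopologicalSpace.isOpen_iUnion_countable (fun x : X => S x)
      (fun x => hSo x)
    rw [Set.biUnion_eq_iUnion, ← hT]
    have := hTc.to_subtype
    rw [Set.biUnion_eq_iUnion]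
    refine AEStronglyMeasurable.iUnion fun z => ?_
    have hz : Integrable (fun y => ((t ^ d)⁻¹ * φ (t⁻¹ • ((z : Rd d) - y))) • f y) volume := z.1.2
    have h1 : AEStronglyMeasurable (fun y => ((t ^ d)⁻¹ * φ (t⁻¹ • ((z : Rd d) - y)))⁻¹ •
        (((t ^ d)⁻¹ * φ (t⁻¹ • ((z : Rd d) - y))) • f y)) (volume.restrict (S z)) := by
      have h2 : Continuous fun y => (t ^ d)⁻¹ * φ (t⁻¹ • ((z : Rd d) - y)) := by fun_prop
      have h3 : AEStronglyMeasurable (fun y => ((t ^ d)⁻¹ * φ (t⁻¹ • ((z : Rd d) - y)))⁻¹)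
        (volume.restrict (S z)) := h2.measurable.inv.aestronglyMeasurable
      exact h3.smul hz.aestronglyMeasurable.restrict
    refine h1.congr ?_
    filter_upwards [ae_restrict_mem (hSo z).measurableSet] with y hy
    rw [smul_smul, inv_mul_cancel₀, one_smul]
    exact mul_ne_zero (by positivity) hy
  · by_cases hx : x ∈ X
    · left
      refine integral_congr_ae (Filter.Eventually.of_forall fun y => ?_)
      by_cases hy : φ (t⁻¹ • (x - y)) = 0
      · simp [hy]
      · have : y ∈ ⋃ x ∈ X, S x := Set.mem_biUnion hx hy
        simp [Set.indicator_of_mem this]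
    · right
      exact integral_undef hx

theorem integral_dilate (hint : ∫ x, φ x = 1) {t : ℝ} (ht : 0 < t) (x : Rd d) :
    ∫ y, (t ^ d)⁻¹ * φ (t⁻¹ • (x - y)) = 1 := by
  rw [integral_sub_left_eq_self (fun z => (t ^ d)⁻¹ * φ (t⁻¹ • z)) volume x,
    integral_const_mul, Measure.integral_comp_inv_smul, hint]
  simp [abs_of_pos ht, ht.ne']

theorem integrable_dilate (hφ : Continuous φ) (hsupp : HasCompactSupport φ) {t : ℝ} (ht : 0 < t)
    (x : Rd d) : Integrable (fun y => (t ^ d)⁻¹ * φ (t⁻¹ • (x - y))) volume := by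
  have h := (hφ.integrable_of_hasCompactSupport (μ := volume) hsupp).comp_smul
    (inv_ne_zero ht.ne')
  exact (h.comp_sub_left x).const_mul _

theorem integrable_mollify_of_bound (hφ : Continuous φ) (hsupp : HasCompactSupport φ)
    {t : ℝ} (ht : 0 < t) {f : Rd d → Cn n} (hf : AEStronglyMeasurable f volume)
    {M : ℝ} (hfM : ∀ x, ‖f x‖ ≤ M) (x : Rd d) :
    Integrable (fun y => ((t ^ d)⁻¹ * φ (t⁻¹ • (x - y))) • f y) volume :=
  (integrable_dilate hφ hsupp ht x).smul_bdd M hf (Filter.Eventually.of_forall hfM)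

theorem norm_mollifyConv_le (hφ : Continuous φ) (hsupp : HasCompactSupport φ)
    (hφ0 : ∀ x, 0 ≤ φ x) (hint : ∫ x, φ x = 1)
    {t : ℝ} (ht : 0 < t) {f : Rd d → Cn n}
    {M : ℝ} (hfM : ∀ x, ‖f x‖ ≤ M) (x : Rd d) : ‖mollifyConv φ t f x‖ ≤ M := by
  calc ‖mollifyConv φ t f x‖ ≤ ∫ y, ((t ^ d)⁻¹ * φ (t⁻¹ • (x - y))) * M := by
        refine norm_integral_le_of_norm_le ((integrable_dilate hφ hsupp ht x).mul_const M)
          (Filter.Eventually.of_forall fun y => ?_)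
        rw [norm_smul, Real.norm_of_nonneg (mul_nonneg (by positivity) (hφ0 _))]
        have := hφ0 (t⁻¹ • (x - y))
        gcongr
        exact hfM y
    _ = M := by rw [integral_mul_const, integral_dilate hint ht, one_mul]

theorem mollifyConv_eq_zero (hφ1 : ∀ x, φ x ≠ 0 → ‖x‖ < 1) {t : ℝ} (ht : 0 < t) (ht1 : t ≤ 1)
    {f : Rd d → Cn n} {R : ℝ} (hfR : ∀ x, R < ‖x‖ → f x = 0) {x : Rd d} (hx : R + 1 < ‖x‖) :
    mollifyConv φ t f x = 0 := by
  refine integral_eq_zero_of_ae (Filter.Eventually.of_forall fun y => ?_)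
  by_cases hy : φ (t⁻¹ • (x - y)) = 0
  · simp [hy]
  · have h1 := hφ1 _ hy
    rw [norm_smul, Real.norm_of_nonneg (by positivity), inv_mul_lt_iff₀ ht, mul_one] at h1
    have h2 := norm_sub_norm_le x y
    simp [hfR y (by linarith)]

theorem ae_tendsto_mollifyConv (hφ : Continuous φ) (hsupp : HasCompactSupport φ)
    (hφ0 : ∀ x, 0 ≤ φ x) (hint : ∫ x, φ x = 1) {L : ℝ} (hφL : ∀ x, φ x ≤ L)
    (hφ1 : ∀ x, φ x ≠ 0 → ‖x‖ < 1)
    {f : Rd d → Cn n} (hf : AEStronglyMeasurable f volume) {M : ℝ} (hfM : ∀ x, ‖f x‖ ≤ M) :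
    ∀ᵐ x, Filter.Tendsto (fun t => mollifyConv φ t f x)
      (nhdsWithin 0 (Set.Ioi 0)) (nhds (f x)) := by
  have hloc : LocallyIntegrable f volume := by
    refine (locallyIntegrable_const M).mono hf (Filter.Eventually.of_forall fun x => ?_)
    exact (hfM x).trans (le_abs_self M)
  filter_upwards [IsUnifLocDoublingMeasure.ae_tendsto_average_norm_sub (μ := volume) hloc 1]
    with x hx
  have hlim := hx (l := nhdsWithin (0 : ℝ) (Set.Ioi 0)) (fun _ => x) id Filter.tendsto_id
    (by
      filter_upwards [self_mem_nhdsWithin] with t ht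
      have : (0 : ℝ) < t := ht
      simp [this.le])
  set v : ℝ := volume.real (Metric.closedBall (0 : Rd d) 1) with hv
  have hlim2 := hlim.const_mul (L * v)
  rw [mul_zero] at hlim2
  refine tendsto_iff_norm_sub_tendsto_zero.2 (squeeze_zero'
    (Filter.Eventually.of_forall fun t => norm_nonneg _) ?_ hlim2)
  filter_upwards [self_mem_nhdsWithin] with t ht
  have ht : 0 < t := ht
  have hL : 0 ≤ L := (hφ0 0).trans (hφL 0)
  have hsub : mollifyConv φ t f x - f x =
      ∫ y, ((t ^ d)⁻¹ * φ (t⁻¹ • (x - y))) • (f y - f x) := by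
    have h (y : Rd d) : ((t ^ d)⁻¹ * φ (t⁻¹ • (x - y))) • (f y - f x) =
      ((t ^ d)⁻¹ * φ (t⁻¹ • (x - y))) • f y - ((t ^ d)⁻¹ * φ (t⁻¹ • (x - y))) • f x :=
      smul_sub _ _ _
    rw [integral_congr_ae (Filter.Eventually.of_forall h), integral_sub
      (integrable_mollify_of_bound hφ hsupp ht hf hfM x)
      ((integrable_dilate hφ hsupp ht x).smul_const _), integral_smul_const,
      integral_dilate hint ht, one_smul]
    rfl
  have hvol : volume.real (Metric.closedBall x t) = t ^ d * v := by
    rw [hv, Measure.real, Measure.addHaar_closedBall _ _ ht.le, ENNReal.toReal_mul,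
      ENNReal.toReal_ofReal (by positivity), Measure.real,
      Measure.addHaar_closedBall _ _ zero_le_one]
    simp
  have hvpos : 0 < v := by
    rw [hv]
    exact ENNReal.toReal_pos (Metric.measure_closedBall_pos volume _ one_pos).ne'
      measure_closedBall_lt_top.ne
  have hint2 : IntegrableOn (fun y => ‖f y - f x‖) (Metric.closedBall x t) volume := by
    refine ((hloc.integrableOn_isCompact (isCompact_closedBall x t)).sub ?_).norm
    exact integrableOn_const measure_closedBall_lt_top.ne
  have hint3 : IntegrableOn (fun y => ((t ^ d)⁻¹ * L) * ‖f y - f x‖) (Metric.closedBall x t)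
    volume := hint2.const_mul _
  calc ‖mollifyConv φ t f x - f x‖
      ≤ ∫ y, (Metric.closedBall x t).indicator (fun y => ((t ^ d)⁻¹ * L) * ‖f y - f x‖) y := by
        rw [hsub]
        refine norm_integral_le_of_norm_le
          (hint3.integrable_indicator measurableSet_closedBall)
          (Filter.Eventually.of_forall fun y => ?_)
        rw [norm_smul, Real.norm_of_nonneg (mul_nonneg (by positivity) (hφ0 _))]
        by_cases hy : φ (t⁻¹ • (x - y)) = 0
        · rw [hy, mul_zero, zero_mul]
          exact Set.indicator_nonneg (fun z _ => by positivity) _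
        · have h1 := hφ1 _ hy
          rw [norm_smul, Real.norm_of_nonneg (by positivity), inv_mul_lt_iff₀ ht, mul_one,
            ← dist_eq_norm, dist_comm] at h1
          rw [Set.indicator_of_mem (Metric.mem_closedBall.2 h1.le)]
          gcongr
          exact hφL _
    _ = ((t ^ d)⁻¹ * L) * ∫ y in Metric.closedBall x t, ‖f y - f x‖ := by
        rw [integral_indicator measurableSet_closedBall, integral_const_mul]
    _ = L * v * ⨍ y in Metric.closedBall x (id t), ‖f y - f x‖ := by
        rw [setAverage_eq, id, hvol, smul_eq_mul]
        field_simp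

end Mollify

section Weighted

variable {d n : ℕ} {p : ℝ} {φ : Rd d → ℝ}

theorem exists_lintegral_mollified_le {U V : Rd d → Mat n} (hp : 1 ≤ p)
    (hU : IsMatrixWeight U) (hV : IsMatrixWeight V) (hAp : matrixApqFull 0 p p U V < ⊤)
    {M : ℝ} (hM : 0 ≤ M) (hφM : ∀ x, φ x ≤ M) (hφ1 : ∀ x, φ x ≠ 0 → ‖x‖ < 1) :
    ∃ C ≠ ⊤, ∀ t : ℝ, 0 < t → ∀ f : Rd d → Cn n, AEStronglyMeasurable f volume →
      ∫⁻ x, (∫⁻ y, ENNReal.ofReal ((t ^ d)⁻¹ * φ (t⁻¹ • (x - y))) *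
          ‖Matrix.toEuclideanCLM (𝕜 := ℂ) (matPow (U x) (1 / p)) (f y)‖ₑ) ^ p ≤
        C * ∫⁻ y, ‖Matrix.toEuclideanCLM (𝕜 := ℂ) (matPow (V y) (1 / p)) (f y)‖ₑ ^ p := by
  obtain ⟨K, hKt, hK⟩ := exists_cube_estimate hp hU hV hAp
  have hp0 : 0 < p := by linarith
  refine ⟨3 ^ d * (ENNReal.ofReal (M * 3 ^ d) ^ p * K), ?_, fun t ht f hf => ?_⟩
  · exact ENNReal.mul_ne_top (by simp)
      (ENNReal.mul_ne_top (ENNReal.rpow_ne_top_of_nonneg hp0.le ENNReal.ofReal_ne_top) hKt)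
  have hg : AEMeasurable
      (fun y => ‖Matrix.toEuclideanCLM (𝕜 := ℂ) (matPow (V y) (1 / p)) (f y)‖ₑ) volume :=
    (isBoundedBilinearMap_apply.continuous.comp_aestronglyMeasurable
      ((aestronglyMeasurable_matPow hV (1 / p)).prodMk hf)).enorm
  refine le_trans (lintegral_mono fun x => ?_)
    (lintegral_rpow_mollified_kernel_le hp0 hK hM hφM hφ1 ht hg)
  refine ENNReal.rpow_le_rpow (lintegral_mono_ae ?_) hp0.le
  filter_upwards [hV.2] with y hy
  gcongr
  refine le_of_eq_of_le ?_ (ContinuousLinearMap.le_opENorm _ _)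
  congr 1
  have h : Matrix.toEuclideanCLM (𝕜 := ℂ) (matPow (U x) (1 / p)) *
      Matrix.toEuclideanCLM (𝕜 := ℂ) (matPow (V y) (-(1 / p))) *
      Matrix.toEuclideanCLM (𝕜 := ℂ) (matPow (V y) (1 / p)) =
      Matrix.toEuclideanCLM (𝕜 := ℂ) (matPow (U x) (1 / p)) := by
    rw [mul_assoc, ← map_mul, matPow_neg_mul_matPow hy, map_one, mul_one]
  exact (DFunLike.congr_fun h (f y)).symm

theorem lintegral_apply_mollifyConv_le (hp : 0 < p) (hφ : Continuous φ) (hφ0 : ∀ x, 0 ≤ φ x)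
    {A B : Rd d → Cn n →L[ℂ] Cn n} {C : ℝ≥0∞} {t : ℝ} (ht : 0 < t)
    (hC : ∀ f : Rd d → Cn n, AEStronglyMeasurable f volume →
      ∫⁻ x, (∫⁻ y, ENNReal.ofReal ((t ^ d)⁻¹ * φ (t⁻¹ • (x - y))) * ‖A x (f y)‖ₑ) ^ p ≤
        C * ∫⁻ y, ‖B y (f y)‖ₑ ^ p) (f : Rd d → Cn n) :
    ∫⁻ x, ‖A x (mollifyConv φ t f x)‖ₑ ^ p ≤ C * ∫⁻ y, ‖B y (f y)‖ₑ ^ p := by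
  obtain ⟨G, hG, hGf, hfG⟩ := exists_aestronglyMeasurable_mollifyConv hφ ht f
  calc ∫⁻ x, ‖A x (mollifyConv φ t f x)‖ₑ ^ p
      ≤ ∫⁻ x, (∫⁻ y, ENNReal.ofReal ((t ^ d)⁻¹ * φ (t⁻¹ • (x - y))) *
          ‖A x (G.indicator f y)‖ₑ) ^ p := by
        refine lintegral_mono fun x => ENNReal.rpow_le_rpow ?_ hp.le
        rcases hfG x with h | h
        · rw [h]
          exact enorm_apply_mollifyConv_le hφ0 ht (A x) _ x
        · simp [h]
    _ ≤ C * ∫⁻ y, ‖B y (G.indicator f y)‖ₑ ^ p := hC _ hGf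
    _ ≤ C * ∫⁻ y, ‖B y (f y)‖ₑ ^ p := by
        gcongr with y
        by_cases hy : y ∈ G
        · simp [hy]
        · simp [hy]

theorem tendsto_lintegral_mollifyConv_sub (hp : 0 < p) (hφ : Continuous φ)
    (hsupp : HasCompactSupport φ) (hφ0 : ∀ x, 0 ≤ φ x) (hint : ∫ x, φ x = 1) {L : ℝ}
    (hφL : ∀ x, φ x ≤ L) (hφ1 : ∀ x, φ x ≠ 0 → ‖x‖ < 1) {A : Rd d → Cn n →L[ℂ] Cn n}
    (hA : AEStronglyMeasurable A volume)
    (hAK : ∀ R : ℝ, ∫⁻ x in Metric.closedBall 0 R, ‖A x‖ₑ ^ p < ⊤) {f : Rd d → Cn n}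
    (hf : AEStronglyMeasurable f volume) {M R : ℝ} (hfM : ∀ x, ‖f x‖ ≤ M)
    (hfR : ∀ x, R < ‖x‖ → f x = 0) :
    Filter.Tendsto (fun t => ∫⁻ x, ‖A x (mollifyConv φ t f x - f x)‖ₑ ^ p)
      (nhdsWithin 0 (Set.Ioi 0)) (nhds 0) := by
  have h0 : ∫⁻ _ : Rd d, (0 : ℝ≥0∞) = 0 := lintegral_zero
  rw [← h0]
  refine tendsto_lintegral_filter_of_dominated_convergence'
    ((Metric.closedBall 0 (R + 1)).indicator
      fun x => ‖A x‖ₑ ^ p * ENNReal.ofReal (M + M) ^ p) ?_ ?_ ?_ ?_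
  · refine Filter.Eventually.of_forall fun t => ?_
    have h : AEStronglyMeasurable (fun x => A x (mollifyConv φ t f x - f x)) volume :=
      isBoundedBilinearMap_apply.continuous.comp_aestronglyMeasurable
        (hA.prodMk ((aestronglyMeasurable_mollifyConv hφ t hf).sub hf))
    exact h.enorm.pow_const p
  · filter_upwards [Ioc_mem_nhdsGT (zero_lt_one (α := ℝ))] with t ht
    refine Filter.Eventually.of_forall fun x => ?_
    by_cases hx : x ∈ Metric.closedBall (0 : Rd d) (R + 1)
    · rw [Set.indicator_of_mem hx, ← ENNReal.mul_rpow_of_nonneg _ _ hp.le]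
      refine ENNReal.rpow_le_rpow ((ContinuousLinearMap.le_opENorm _ _).trans ?_) hp.le
      gcongr
      rw [← ofReal_norm]
      refine ENNReal.ofReal_le_ofReal ((norm_sub_le _ _).trans (add_le_add ?_ (hfM x)))
      exact norm_mollifyConv_le hφ hsupp hφ0 hint ht.1 hfM x
    · rw [mem_closedBall_zero_iff, not_le] at hx
      rw [mollifyConv_eq_zero hφ1 ht.1 ht.2 hfR hx, hfR x (by linarith)]
      simp [hp]
  · rw [lintegral_indicator measurableSet_closedBall,
      lintegral_mul_const' _ _ (ENNReal.rpow_ne_top_of_nonneg hp.le ENNReal.ofReal_ne_top)]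
    exact ENNReal.mul_ne_top (hAK _).ne (ENNReal.rpow_ne_top_of_nonneg hp.le ENNReal.ofReal_ne_top)
  · filter_upwards [ae_tendsto_mollifyConv hφ hsupp hφ0 hint hφL hφ1 hf hfM] with x hx
    have h1 := ((A x).continuous.tendsto _).comp (hx.sub_const (f x))
    have h2 := (ENNReal.continuous_rpow_const (y := p)).continuousAt.tendsto.comp h1.enorm
    simpa [Function.comp_def, hp] using h2

theorem eLpNorm'_sub_le_add {f g : Rd d → Cn n} (hf : AEStronglyMeasurable f volume)
    (hg : AEStronglyMeasurable g volume) (hp : 1 ≤ p) :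
    eLpNorm' (f - g) p volume ≤ eLpNorm' f p volume + eLpNorm' g p volume := by
  rw [sub_eq_add_neg]
  exact (eLpNorm'_add_le hf hg.neg hp).trans_eq (by rw [eLpNorm'_neg])

/-- The restriction of `f` to the set where both the argument and the value are at most `k`. -/
def truncate (f : Rd d → Cn n) (k : ℕ) : Rd d → Cn n :=
  {x | ‖f x‖ ≤ k ∧ ‖x‖ ≤ k}.indicator f

theorem norm_truncate_le (f : Rd d → Cn n) (k : ℕ) (x : Rd d) : ‖truncate f k x‖ ≤ k := by
  rw [truncate, Set.indicator_apply]
  split_ifs with h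
  · exact h.1
  · simp

theorem truncate_eq_zero (f : Rd d → Cn n) (k : ℕ) (x : Rd d) (hx : (k : ℝ) < ‖x‖) :
    truncate f k x = 0 :=
  Set.indicator_of_notMem (fun h => hx.not_ge h.2) _

theorem aestronglyMeasurable_truncate {f : Rd d → Cn n} (hf : AEStronglyMeasurable f volume)
    (k : ℕ) : AEStronglyMeasurable (truncate f k) volume := by
  refine hf.indicator₀ (NullMeasurableSet.inter ?_ ?_)
  · exact nullMeasurableSet_le hf.norm.aemeasurable aemeasurable_const
  · exact (measurableSet_le measurable_norm measurable_const).nullMeasurableSet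

theorem eventually_truncate_eq (f : Rd d → Cn n) (x : Rd d) :
    ∀ᶠ k in Filter.atTop, truncate f k x = f x := by
  filter_upwards [Filter.eventually_ge_atTop ⌈max ‖f x‖ ‖x‖⌉₊] with k hk
  have h := Nat.ceil_le.1 hk
  exact Set.indicator_of_mem (show x ∈ {x | ‖f x‖ ≤ k ∧ ‖x‖ ≤ k} from max_le_iff.1 h) _

theorem enorm_apply_truncate_le (f : Rd d → Cn n) (k : ℕ) (B : Cn n →L[ℂ] Cn n) (x : Rd d) :
    ‖B (truncate f k x)‖ₑ ≤ ‖B (f x)‖ₑ := by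
  rw [truncate, Set.indicator_apply]
  split_ifs <;> simp

theorem enorm_apply_sub_truncate_le (f : Rd d → Cn n) (k : ℕ) (B : Cn n →L[ℂ] Cn n) (x : Rd d) :
    ‖B (f x - truncate f k x)‖ₑ ≤ ‖B (f x)‖ₑ := by
  rw [truncate, Set.indicator_apply]
  split_ifs <;> simp

theorem tendsto_eLpNorm'_sub_truncate (hp : 0 < p) {B : Rd d → Cn n →L[ℂ] Cn n}
    (hB : AEStronglyMeasurable B volume) {f : Rd d → Cn n} (hf : AEStronglyMeasurable f volume)
    (hfB : ∫⁻ x, ‖B x (f x)‖ₑ ^ p < ⊤) :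
    Filter.Tendsto (fun k => eLpNorm' (fun x => B x (f x - truncate f k x)) p volume)
      Filter.atTop (nhds 0) := by
  have h : Filter.Tendsto (fun k => ∫⁻ x, ‖B x (f x - truncate f k x)‖ₑ ^ p)
      Filter.atTop (nhds (∫⁻ _ : Rd d, 0)) := by
    refine tendsto_lintegral_of_dominated_convergence' (fun x => ‖B x (f x)‖ₑ ^ p)
      (fun k => ?_) (fun k => ?_) hfB.ne ?_
    · have h : AEStronglyMeasurable (fun x => B x (f x - truncate f k x)) volume :=
        isBoundedBilinearMap_apply.continuous.comp_aestronglyMeasurable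
          (hB.prodMk (hf.sub (aestronglyMeasurable_truncate hf k)))
      exact h.enorm.pow_const p
    · exact Filter.Eventually.of_forall fun x =>
        ENNReal.rpow_le_rpow (enorm_apply_sub_truncate_le f k (B x) x) hp.le
    · refine Filter.Eventually.of_forall fun x => tendsto_const_nhds.congr' ?_
      filter_upwards [eventually_truncate_eq f x] with k hk
      simp [hk, hp]
  have h2 := (ENNReal.continuous_rpow_const (y := 1 / p)).continuousAt.tendsto.comp h
  simpa [Function.comp_def, eLpNorm', hp] using h2

theorem eLpNorm'_apply_le_of_lintegral_le (hp : 0 < p) {A B : Rd d → Cn n →L[ℂ] Cn n}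
    {f g : Rd d → Cn n} {C : ℝ≥0∞}
    (h : ∫⁻ x, ‖A x (f x)‖ₑ ^ p ≤ C * ∫⁻ x, ‖B x (g x)‖ₑ ^ p) :
    eLpNorm' (fun x => A x (f x)) p volume ≤
      C ^ (1 / p) * eLpNorm' (fun x => B x (g x)) p volume := by
  rw [eLpNorm', eLpNorm', ← ENNReal.mul_rpow_of_nonneg _ _ (by positivity)]
  exact ENNReal.rpow_le_rpow h (by positivity)

/-- The hypotheses on the mollifier that the convergence argument uses. -/
structure IsMollifier (φ : Rd d → ℝ) : Prop where
  continuous : Continuous φ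
  hasCompactSupport : HasCompactSupport φ
  nonneg : ∀ x, 0 ≤ φ x
  le_zero : ∀ x, φ x ≤ φ 0
  norm_lt_one : ∀ x, φ x ≠ 0 → ‖x‖ < 1
  integral_eq_one : ∫ x, φ x = 1

/-- The uniform bound for mollification from the norm given by `B` to the one given by `A`. -/
def MollifiedBound (p : ℝ) (φ : Rd d → ℝ) (A B : Rd d → Cn n →L[ℂ] Cn n) (C : ℝ≥0∞) : Prop :=
  ∀ t : ℝ, 0 < t → ∀ f : Rd d → Cn n, AEStronglyMeasurable f volume →
    ∫⁻ x, (∫⁻ y, ENNReal.ofReal ((t ^ d)⁻¹ * φ (t⁻¹ • (x - y))) * ‖A x (f y)‖ₑ) ^ p ≤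
      C * ∫⁻ y, ‖B y (f y)‖ₑ ^ p

theorem MollifiedBound.eLpNorm'_mollifyConv_le (hp : 0 < p) (hφ : IsMollifier φ)
    {A B : Rd d → Cn n →L[ℂ] Cn n} {C : ℝ≥0∞} (hC : MollifiedBound p φ A B C) {t : ℝ}
    (ht : 0 < t) (f : Rd d → Cn n) :
    eLpNorm' (fun x => A x (mollifyConv φ t f x)) p volume ≤
      C ^ (1 / p) * eLpNorm' (fun x => B x (f x)) p volume :=
  eLpNorm'_apply_le_of_lintegral_le hp
    (lintegral_apply_mollifyConv_le hp hφ.continuous hφ.nonneg ht (hC t ht) f)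

theorem tendsto_eLpNorm'_mollifyConv_truncate_sub (hp : 0 < p) (hφ : IsMollifier φ)
    {A : Rd d → Cn n →L[ℂ] Cn n} (hA : AEStronglyMeasurable A volume)
    (hAK : ∀ R : ℝ, ∫⁻ x in Metric.closedBall 0 R, ‖A x‖ₑ ^ p < ⊤) {f : Rd d → Cn n}
    (hf : AEStronglyMeasurable f volume) (k : ℕ) :
    Filter.Tendsto
      (fun t =>
        eLpNorm' (fun x => A x (mollifyConv φ t (truncate f k) x - truncate f k x)) p volume)
      (nhdsWithin 0 (Set.Ioi 0)) (nhds 0) := by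
  have h := tendsto_lintegral_mollifyConv_sub hp hφ.continuous hφ.hasCompactSupport hφ.nonneg
    hφ.integral_eq_one hφ.le_zero hφ.norm_lt_one hA hAK (aestronglyMeasurable_truncate hf k)
    (norm_truncate_le f k) (truncate_eq_zero f k)
  have h2 := (ENNReal.continuous_rpow_const (y := 1 / p)).continuousAt.tendsto.comp h
  simpa [Function.comp_def, eLpNorm', hp] using h2

theorem aestronglyMeasurable_apply {A : Rd d → Cn n →L[ℂ] Cn n}
    (hA : AEStronglyMeasurable A volume) {f : Rd d → Cn n} (hf : AEStronglyMeasurable f volume) :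
    AEStronglyMeasurable (fun x => A x (f x)) volume :=
  isBoundedBilinearMap_apply.continuous.comp_aestronglyMeasurable (hA.prodMk hf)

theorem MollifiedBound.eLpNorm'_truncate_le (hp : 1 ≤ p) (hφ : IsMollifier φ)
    {A B : Rd d → Cn n →L[ℂ] Cn n} {C : ℝ≥0∞} (hC : MollifiedBound p φ A B C)
    (hA : AEStronglyMeasurable A volume)
    (hAK : ∀ R : ℝ, ∫⁻ x in Metric.closedBall 0 R, ‖A x‖ₑ ^ p < ⊤) {f : Rd d → Cn n}
    (hf : AEStronglyMeasurable f volume) (k : ℕ) :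
    eLpNorm' (fun x => A x (truncate f k x)) p volume ≤
      C ^ (1 / p) * eLpNorm' (fun x => B x (truncate f k x)) p volume := by
  have hp0 : 0 < p := by linarith
  have hk := aestronglyMeasurable_truncate hf k
  have h := (tendsto_eLpNorm'_mollifyConv_truncate_sub hp0 hφ hA hAK hf k).const_add
    (C ^ (1 / p) * eLpNorm' (fun x => B x (truncate f k x)) p volume)
  rw [add_zero] at h
  refine ge_of_tendsto h ?_
  filter_upwards [self_mem_nhdsWithin] with t ht
  have hm := aestronglyMeasurable_mollifyConv hφ.continuous t hk
  refine le_trans ?_ (add_le_add (hC.eLpNorm'_mollifyConv_le hp0 hφ ht _) le_rfl)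
  refine le_trans (le_of_eq ?_) (eLpNorm'_sub_le_add (aestronglyMeasurable_apply hA hm)
    (aestronglyMeasurable_apply hA (hm.sub hk)) hp)
  congr 1
  ext1 x
  simp

theorem MollifiedBound.eLpNorm'_le (hp : 1 ≤ p) (hφ : IsMollifier φ)
    {A B : Rd d → Cn n →L[ℂ] Cn n} {C : ℝ≥0∞} (hC : MollifiedBound p φ A B C)
    (hA : AEStronglyMeasurable A volume)
    (hAK : ∀ R : ℝ, ∫⁻ x in Metric.closedBall 0 R, ‖A x‖ₑ ^ p < ⊤) {f : Rd d → Cn n}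
    (hf : AEStronglyMeasurable f volume) :
    eLpNorm' (fun x => A x (f x)) p volume ≤
      C ^ (1 / p) * eLpNorm' (fun x => B x (f x)) p volume := by
  have hp0 : 0 < p := by linarith
  have h : Filter.Tendsto (fun k => eLpNorm' (fun x => A x (truncate f k x)) p volume)
      Filter.atTop (nhds (eLpNorm' (fun x => A x (f x)) p volume)) := by
    refine ((ENNReal.continuous_rpow_const (y := 1 / p)).tendsto _).comp
      (lintegral_tendsto_of_tendsto_of_monotone (fun k => ?_) ?_ ?_)
    · exact (aestronglyMeasurable_apply hA (aestronglyMeasurable_truncate hf k)).enorm.pow_const p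
    · refine Filter.Eventually.of_forall fun x k l hkl => ENNReal.rpow_le_rpow ?_ hp0.le
      beta_reduce
      rw [truncate, Set.indicator_apply]
      split_ifs with hx
      · have hkl' : (k : ℝ) ≤ l := by exact_mod_cast hkl
        have hx' : x ∈ {x | ‖f x‖ ≤ l ∧ ‖x‖ ≤ l} := ⟨hx.1.trans hkl', hx.2.trans hkl'⟩
        rw [truncate, Set.indicator_of_mem hx']
      · simp
    · refine Filter.Eventually.of_forall fun x => tendsto_const_nhds.congr' ?_
      filter_upwards [eventually_truncate_eq f x] with k hk
      rw [hk]
  refine le_of_tendsto' h fun k => (hC.eLpNorm'_truncate_le hp hφ hA hAK hf k).trans ?_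
  gcongr
  rw [eLpNorm', eLpNorm']
  gcongr with x
  exact enorm_apply_truncate_le f k (B x) x

theorem MollifiedBound.ae_integrable (hp : 0 < p) (hφ : IsMollifier φ)
    {A B A' : Rd d → Cn n →L[ℂ] Cn n} {C : ℝ≥0∞} (hC : MollifiedBound p φ A B C) (hCt : C ≠ ⊤)
    (hA : AEStronglyMeasurable A volume) (hA' : ∀ᵐ x, ∀ v, A' x (A x v) = v) {f : Rd d → Cn n}
    (hf : AEStronglyMeasurable f volume) (hfB : ∫⁻ x, ‖B x (f x)‖ₑ ^ p < ⊤) {t : ℝ} (ht : 0 < t) :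
    ∀ᵐ x, Integrable (fun y => ((t ^ d)⁻¹ * φ (t⁻¹ • (x - y))) • f y) volume := by
  have hφc := hφ.continuous
  have h1 : AEStronglyMeasurable (fun z : Rd d × Rd d => A z.1) (volume.prod volume) := hA.comp_fst
  have h2 : AEStronglyMeasurable (fun z : Rd d × Rd d => f z.2) (volume.prod volume) := hf.comp_snd
  have h3 : AEStronglyMeasurable (fun z : Rd d × Rd d => A z.1 (f z.2)) (volume.prod volume) :=
    isBoundedBilinearMap_apply.continuous.comp_aestronglyMeasurable (h1.prodMk h2)
  have h4 : Continuous (fun z : Rd d × Rd d => (t ^ d)⁻¹ * φ (t⁻¹ • (z.1 - z.2))) := by fun_prop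
  have h5 : AEMeasurable (fun z : Rd d × Rd d =>
      ENNReal.ofReal ((t ^ d)⁻¹ * φ (t⁻¹ • (z.1 - z.2))) * ‖A z.1 (f z.2)‖ₑ)
      (volume.prod volume) := h4.measurable.ennreal_ofReal.aemeasurable.mul h3.enorm
  have hfin := (hC t ht f hf).trans_lt (ENNReal.mul_lt_top hCt.lt_top hfB)
  filter_upwards [ae_lt_top' (h5.lintegral_prod_right'.pow_const p) hfin.ne, hA'] with x hx hAx
  have hx' := (ENNReal.rpow_lt_top_iff_of_pos hp).1 hx
  have h6 : Continuous (fun y : Rd d => (t ^ d)⁻¹ * φ (t⁻¹ • (x - y))) := by fun_prop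
  refine ⟨h6.aestronglyMeasurable.smul hf, ?_⟩
  refine lt_of_le_of_lt ?_ (ENNReal.mul_lt_top (enorm_lt_top (x := A' x)) hx')
  rw [← lintegral_const_mul' _ _ enorm_ne_top]
  refine lintegral_mono fun y => ?_
  rw [enorm_smul, Real.enorm_of_nonneg (mul_nonneg (by positivity) (hφ.nonneg _)), mul_left_comm]
  gcongr
  exact (congrArg enorm (hAx (f y))).symm.le.trans (ContinuousLinearMap.le_opENorm _ _)

theorem MollifiedBound.tendsto_eLpNorm'_mollifyConv_sub (hp : 1 ≤ p) (hφ : IsMollifier φ)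
    {A B A' : Rd d → Cn n →L[ℂ] Cn n} {C : ℝ≥0∞} (hC : MollifiedBound p φ A B C) (hCt : C ≠ ⊤)
    (hA : AEStronglyMeasurable A volume) (hB : AEStronglyMeasurable B volume)
    (hAK : ∀ R : ℝ, ∫⁻ x in Metric.closedBall 0 R, ‖A x‖ₑ ^ p < ⊤)
    (hA' : ∀ᵐ x, ∀ v, A' x (A x v) = v) {f : Rd d → Cn n}
    (hf : AEStronglyMeasurable f volume) (hfB : ∫⁻ x, ‖B x (f x)‖ₑ ^ p < ⊤) :
    Filter.Tendsto (fun t => eLpNorm' (fun x => A x (mollifyConv φ t f x - f x)) p volume)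
      (nhdsWithin 0 (Set.Ioi 0)) (nhds 0) := by
  have hp0 : 0 < p := by linarith
  set D := C ^ (1 / p) with hD
  have hDt : D ≠ ⊤ := ENNReal.rpow_ne_top_of_nonneg (by positivity) hCt
  refine ENNReal.tendsto_nhds_zero.2 fun ε hε => ?_
  have hε2 : 0 < ε / 2 := ENNReal.half_pos hε.ne'
  have hlim := ENNReal.Tendsto.const_mul (a := D + D)
    (tendsto_eLpNorm'_sub_truncate hp0 hB hf hfB) (Or.inr (ENNReal.add_ne_top.2 ⟨hDt, hDt⟩))
  rw [mul_zero] at hlim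
  obtain ⟨k, hk⟩ := (ENNReal.tendsto_nhds_zero.1 hlim _ hε2).exists
  have hkm := aestronglyMeasurable_truncate hf k
  filter_upwards [self_mem_nhdsWithin, ENNReal.tendsto_nhds_zero.1
    (tendsto_eLpNorm'_mollifyConv_truncate_sub hp0 hφ hA hAK hf k) _ hε2] with t ht hkt
  have hsub : AEStronglyMeasurable (fun x => f x - truncate f k x) volume := hf.sub hkm
  have hm1 := aestronglyMeasurable_mollifyConv hφ.continuous t hsub
  have hm2 := aestronglyMeasurable_mollifyConv hφ.continuous t hkm
  have hdec : (fun x => A x (mollifyConv φ t f x - f x)) =ᵐ[volume]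
      ((fun x => A x (mollifyConv φ t (fun x => f x - truncate f k x) x)) -
        fun x => A x (f x - truncate f k x)) +
        fun x => A x (mollifyConv φ t (truncate f k) x - truncate f k x) := by
    filter_upwards [hC.ae_integrable hp0 hφ hCt hA hA' hf hfB ht] with x hx
    have h : mollifyConv φ t (fun x => f x - truncate f k x) x =
        mollifyConv φ t f x - mollifyConv φ t (truncate f k) x := by
      rw [mollifyConv, mollifyConv, mollifyConv, ← integral_sub hx
        (integrable_mollify_of_bound hφ.continuous hφ.hasCompactSupport ht hkm
          (norm_truncate_le f k) x)]
      exact integral_congr_ae (Filter.Eventually.of_forall fun y => smul_sub _ _ _)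
    simp only [Pi.add_apply, Pi.sub_apply, ← map_sub, ← map_add, h]
    congr 1
    abel
  have ha1 := aestronglyMeasurable_apply hA hm1
  have ha2 := aestronglyMeasurable_apply hA hsub
  have ha3 := aestronglyMeasurable_apply hA (hm2.sub hkm)
  rw [eLpNorm'_congr_ae hdec]
  refine (eLpNorm'_add_le (ha1.sub ha2) ha3 hp).trans ?_
  rw [← ENNReal.add_halves ε]
  refine add_le_add ((eLpNorm'_sub_le_add ha1 ha2 hp).trans (le_trans ?_ hk)) hkt
  rw [add_mul]
  exact add_le_add (hC.eLpNorm'_mollifyConv_le hp0 hφ ht _) (hC.eLpNorm'_le hp hφ hA hAK hsub)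

end Weighted

/-- **Corollary 6.2.**  If `(U,V) ∈ A_p` and `φ` is a smooth nonnegative radially symmetric
decreasing mollifier supported in the unit ball with integral one, then the operators
`f ↦ φ_t * f` are uniformly bounded from `L^p(V)` to `L^p(U)`, and `φ_t * f → f` in `L^p(U)`
for every `f ∈ L^p(V)`. -/
theorem convolution_bound (d n : ℕ) (p : ℝ) (hp : 1 ≤ p)
    (U V : Rd d → Mat n) (hU : IsMatrixWeight U) (hV : IsMatrixWeight V)
    (hAp : matrixApqFull 0 p p U V < ⊤)
    (φ : Rd d → ℝ) (hsmooth : ContDiff ℝ (⊤ : ℕ∞) φ) (hsupp : HasCompactSupport φ)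
    (hball : tsupport φ ⊆ Metric.ball 0 1) (hpos : ∀ x, 0 ≤ φ x)
    (hradial : ∀ x y : Rd d, ‖x‖ = ‖y‖ → φ x = φ y)
    (hdecr : ∀ x y : Rd d, ‖x‖ ≤ ‖y‖ → φ y ≤ φ x)
    (hint : ∫ x, φ x = 1) :
    (∃ C : ℝ, 0 < C ∧ ∀ t : ℝ, 0 < t → ∀ f : Rd d → Cn n,
        wLpNorm p U (mollifyConv φ t f) ≤ ENNReal.ofReal C * wLpNorm p V f) ∧
    (∀ f : Rd d → Cn n, AEStronglyMeasurable f volume → wLpNorm p V f < ⊤ →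
        Filter.Tendsto (fun t => wLpNorm p U fun x => mollifyConv φ t f x - f x)
          (nhdsWithin 0 (Set.Ioi 0)) (nhds 0)) := by
  have hp0 : 0 < p := by linarith
  have hφ : IsMollifier φ :=
    { continuous := hsmooth.continuous
      hasCompactSupport := hsupp
      nonneg := hpos
      le_zero := fun x => hdecr 0 x (by simp)
      norm_lt_one := fun x hx => mem_ball_zero_iff.1 (hball (subset_tsupport φ hx))
      integral_eq_one := hint }
  obtain ⟨C, hCt, hC⟩ := exists_lintegral_mollified_le hp hU hV hAp (hpos 0) hφ.le_zero
    hφ.norm_lt_one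
  have hC : MollifiedBound p φ (fun x => Matrix.toEuclideanCLM (𝕜 := ℂ) (matPow (U x) (1 / p)))
    (fun x => Matrix.toEuclideanCLM (𝕜 := ℂ) (matPow (V x) (1 / p))) C := hC
  refine ⟨⟨(C ^ (1 / p)).toReal + 1, by positivity, fun t ht f => ?_⟩, fun f hf hfV => ?_⟩
  · refine (hC.eLpNorm'_mollifyConv_le hp0 hφ ht f).trans ?_
    refine mul_le_mul_left ?_ _
    rw [← ENNReal.ofReal_toReal (ENNReal.rpow_ne_top_of_nonneg (by positivity) hCt)]
    exact ENNReal.ofReal_le_ofReal (by simp)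
  · refine hC.tendsto_eLpNorm'_mollifyConv_sub hp hφ hCt (aestronglyMeasurable_matPow hU _)
      (aestronglyMeasurable_matPow hV _)
      (fun R => lintegral_enorm_matPow_lt_top hU hp0 (isCompact_closedBall 0 R))
      (A' := fun x => Matrix.toEuclideanCLM (𝕜 := ℂ) (matPow (U x) (-(1 / p)))) ?_ hf
      ((ENNReal.rpow_lt_top_iff_of_pos (by positivity)).1 hfV)
    filter_upwards [hU.2] with x hx v
    have h : Matrix.toEuclideanCLM (𝕜 := ℂ) (matPow (U x) (-(1 / p))) *
        Matrix.toEuclideanCLM (𝕜 := ℂ) (matPow (U x) (1 / p)) = 1 := by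
      rw [← map_mul, matPow_neg_mul_matPow hx, map_one]
    exact DFunLike.congr_fun h v

end
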